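/- arXiv:2505.20337 — 2 statements merged into one kernel-verified Lean document; each statement's English description precedes it below -/
import Mathlib

section
/- Let N, L ≥ 1 and let the data entries x_{l,n,i} (l ∈ [L], n ∈ [N], i ∈ [3]) be independent real Gaussians x_{l,n,i} ~ N(μ_{l,n,i}, σ_{l,n,i}²) with σ_{l,n,i}² ≥ σ² > 0. Let U_1, …, U_L be arbitrary 2^N × 2^N unitaries, ρ(x) = (U_L R_L(x_{[L]}) ⋯ U_1 R_1(x_{[1]})) ρ₀ (⋯)† with ρ₀ = (|0⟩⟨0|)^{⊗N}, and let H be a 2^N × 2^N Hermitian matrix all of whose eigenvalues lie in [−1,1]. Fix ε ∈ (0,1). If L ≥ (1/σ²)·((N+2)·ln 2 + 2·ln(1/ε)), then |E_x[Tr[H ρ(x)]] − Tr[H]/2^N| ≤ ε, where the expectation is over the product Gaussian measure. -/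
open Matrix MeasureTheory ProbabilityTheory
open scoped NNReal ENNReal ComplexOrder

noncomputable section

/-- Pauli X matrix. -/
def PX : Matrix (Fin 2) (Fin 2) ℂ := !![0, 1; 1, 0]

/-- Pauli Y matrix. -/
def PY : Matrix (Fin 2) (Fin 2) ℂ := !![0, -Complex.I; Complex.I, 0]

/-- Pauli Z matrix. -/
def PZ : Matrix (Fin 2) (Fin 2) ℂ := !![1, 0; 0, -1]

/-- Rotation gate `exp(-i·x·P/2) = cos(x/2)·I - i·sin(x/2)·P` for a Pauli matrix `P`. -/
def rotG (P : Matrix (Fin 2) (Fin 2) ℂ) (x : ℝ) : Matrix (Fin 2) (Fin 2) ℂ :=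
  (Real.cos (x / 2) : ℂ) • (1 : Matrix (Fin 2) (Fin 2) ℂ)
    - (Complex.I * (Real.sin (x / 2) : ℂ)) • P

/-- `R_z` rotation gate. -/
def Rz (x : ℝ) : Matrix (Fin 2) (Fin 2) ℂ := rotG PZ x

/-- `R_y` rotation gate. -/
def Ry (x : ℝ) : Matrix (Fin 2) (Fin 2) ℂ := rotG PY x

/-- Single-qubit encoding gate `R(v) = R_z(v₃) R_y(v₂) R_z(v₁)`. -/
def encGate (v : Fin 3 → ℝ) : Matrix (Fin 2) (Fin 2) ℂ :=
  Rz (v 2) * Ry (v 1) * Rz (v 0)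

/-- Kronecker product of a family of `2 × 2` matrices, indexed by `Fin N → Fin 2`. -/
def kron {N : ℕ} (A : Fin N → Matrix (Fin 2) (Fin 2) ℂ) :
    Matrix (Fin N → Fin 2) (Fin N → Fin 2) ℂ :=
  Matrix.of fun i j => ∏ n, A n (i n) (j n)

/-- Encoding-layer gate `R_l(x_{[l]}) = ⊗ₙ R(x_{l,n})`. -/
def layerGate {N : ℕ} (x : Fin N → Fin 3 → ℝ) :
    Matrix (Fin N → Fin 2) (Fin N → Fin 2) ℂ :=
  kron fun n => encGate (x n)

/-- `|0⟩⟨0|`. -/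
def ket0 : Matrix (Fin 2) (Fin 2) ℂ := !![1, 0; 0, 0]

/-- The initial state `ρ₀ = (|0⟩⟨0|)^{⊗N}`. -/
def rho0 (N : ℕ) : Matrix (Fin N → Fin 2) (Fin N → Fin 2) ℂ := kron fun _ => ket0

section HilbertSchmidt

variable {m : Type*} [Fintype m]

/-- Squared Hilbert–Schmidt norm of a complex matrix. -/
def hsSq (M : Matrix m m ℂ) : ℝ := ∑ i, ∑ j, ‖M i j‖ ^ 2

/-- Contribution of the diagonal entries to `hsSq`. -/
def diagSq (M : Matrix m m ℂ) : ℝ := ∑ i, ‖M i i‖ ^ 2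

/-- Contribution of the off-diagonal entries to `hsSq`. -/
def offDiagSq [DecidableEq m] (M : Matrix m m ℂ) : ℝ :=
  ∑ i, ∑ j, if i = j then 0 else ‖M i j‖ ^ 2

lemma hsSq_nonneg (M : Matrix m m ℂ) : 0 ≤ hsSq M := by
  unfold hsSq; positivity

lemma diagSq_le_hsSq (M : Matrix m m ℂ) : diagSq M ≤ hsSq M :=
  Finset.sum_le_sum fun i _ =>
    Finset.single_le_sum (f := fun j => ‖M i j‖ ^ 2) (fun _ _ => by positivity)
      (Finset.mem_univ i)

lemma hsSq_eq_trace (M : Matrix m m ℂ) : (hsSq M : ℂ) = (Mᴴ * M).trace := by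
  simp only [hsSq, Matrix.trace, Matrix.diag, Matrix.mul_apply, Matrix.conjTranspose_apply]
  rw [Finset.sum_comm]
  push_cast
  refine Finset.sum_congr rfl fun j _ => Finset.sum_congr rfl fun i _ => ?_
  rw [← Complex.conj_mul']
  rfl

lemma norm_trace_mul_sq_le (A B : Matrix m m ℂ) :
    ‖(A * B).trace‖ ^ 2 ≤ hsSq A * hsSq B := by
  have h1 : ‖(A * B).trace‖ ≤ ∑ p : m × m, ‖A p.1 p.2‖ * ‖B p.2 p.1‖ := by
    simp only [Matrix.trace, Matrix.diag, Matrix.mul_apply, Fintype.sum_prod_type]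
    refine (norm_sum_le _ _).trans (Finset.sum_le_sum fun i _ => (norm_sum_le _ _).trans ?_)
    exact Finset.sum_le_sum fun j _ => (norm_mul _ _).le
  have h2 := Finset.sum_mul_sq_le_sq_mul_sq Finset.univ (fun p : m × m => ‖A p.1 p.2‖)
    (fun p => ‖B p.2 p.1‖)
  refine (pow_le_pow_left₀ (norm_nonneg _) h1 2).trans (h2.trans_eq ?_)
  simp only [hsSq, Fintype.sum_prod_type]
  rw [Finset.sum_comm (f := fun x y => ‖B y x‖ ^ 2)]

variable [DecidableEq m]

lemma diagSq_add_offDiagSq (M : Matrix m m ℂ) : diagSq M + offDiagSq M = hsSq M := by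
  simp only [diagSq, offDiagSq, hsSq, ← Finset.sum_add_distrib]
  refine Finset.sum_congr rfl fun i _ => ?_
  have h : ‖M i i‖ ^ 2 = ∑ j, if i = j then ‖M i j‖ ^ 2 else 0 := by simp
  rw [h, ← Finset.sum_add_distrib]
  exact Finset.sum_congr rfl fun j _ => by split_ifs <;> simp

lemma hsSq_unitary_conj {U : Matrix m m ℂ} (hU : U ∈ Matrix.unitaryGroup m ℂ)
    (M : Matrix m m ℂ) : hsSq (U * M * Uᴴ) = hsSq M := by
  have hU' : Uᴴ * U = 1 := Matrix.mem_unitaryGroup_iff'.1 hU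
  have h : ((hsSq (U * M * Uᴴ) : ℝ) : ℂ) = hsSq M := by
    rw [hsSq_eq_trace, hsSq_eq_trace]
    have : (U * M * Uᴴ)ᴴ * (U * M * Uᴴ) = U * (Mᴴ * M * Uᴴ) := by
      simp only [Matrix.conjTranspose_mul, Matrix.conjTranspose_conjTranspose, Matrix.mul_assoc]
      rw [← Matrix.mul_assoc Uᴴ U, hU', Matrix.one_mul]
    rw [this, Matrix.trace_mul_comm, Matrix.mul_assoc, hU', Matrix.mul_one]
  exact_mod_cast h

lemma trace_unitary_conj {U : Matrix m m ℂ} (hU : U ∈ Matrix.unitaryGroup m ℂ)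
    (M : Matrix m m ℂ) : (U * M * Uᴴ).trace = M.trace := by
  have hU' : Uᴴ * U = 1 := Matrix.mem_unitaryGroup_iff'.1 hU
  rw [Matrix.trace_mul_comm, ← Matrix.mul_assoc, hU', Matrix.one_mul]

lemma conjTranspose_mem_unitaryGroup {U : Matrix m m ℂ} (hU : U ∈ Matrix.unitaryGroup m ℂ) :
    Uᴴ ∈ Matrix.unitaryGroup m ℂ := by
  rw [Matrix.mem_unitaryGroup_iff, Matrix.star_eq_conjTranspose,
    Matrix.conjTranspose_conjTranspose]
  exact Matrix.mem_unitaryGroup_iff'.1 hU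

lemma hsSq_le_card_of_eigenvalues {H : Matrix m m ℂ} (hH : H.IsHermitian)
    (hEig : ∀ i, hH.eigenvalues i ∈ Set.Icc (-1 : ℝ) 1) : hsSq H ≤ Fintype.card m := by
  have hs : H = (hH.eigenvectorUnitary : Matrix m m ℂ) *
      Matrix.diagonal (fun i => (hH.eigenvalues i : ℂ)) *
      (hH.eigenvectorUnitary : Matrix m m ℂ)ᴴ := by
    simpa [Unitary.conjStarAlgAut_apply, Function.comp_def, Matrix.star_eq_conjTranspose]
      using hH.spectral_theorem
  rw [hs, hsSq_unitary_conj hH.eigenvectorUnitary.2]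
  have : ∀ i, ∑ j, ‖Matrix.diagonal (fun i => (hH.eigenvalues i : ℂ)) i j‖ ^ 2 ≤ 1 := by
    intro i
    rw [Finset.sum_eq_single i (fun j _ hj => by simp [Matrix.diagonal_apply_ne' _ hj])
      (by simp)]
    simpa using abs_le.2 (hEig i)
  exact (Finset.sum_le_sum fun i _ => this i).trans (by simp)

end HilbertSchmidt

section Dephasing

variable {m : Type*}

/-- Schur multipliers that fix the diagonal and shrink the off-diagonal entries by `q`. -/
structure IsDephasing (C : Matrix m m ℂ) (q : ℝ) : Prop where
  diag : ∀ i, C i i = 1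
  off : ∀ i j, i ≠ j → ‖C i j‖ ≤ q

namespace IsDephasing

variable {C : Matrix m m ℂ} {q : ℝ}

lemma hadamard_one [DecidableEq m] (hC : IsDephasing C q) : C ⊙ (1 : Matrix m m ℂ) = 1 := by
  ext i j
  by_cases h : i = j
  · subst h; simp [hC.diag]
  · simp [Matrix.one_apply_ne h]

lemma trace_hadamard [Fintype m] (hC : IsDephasing C q) (M : Matrix m m ℂ) :
    (C ⊙ M).trace = M.trace := by
  simp [Matrix.trace, hC.diag]

lemma diagSq_hadamard [Fintype m] (hC : IsDephasing C q) (M : Matrix m m ℂ) :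
    diagSq (C ⊙ M) = diagSq M := by
  simp [diagSq, hC.diag]

variable [Fintype m] [DecidableEq m]

lemma offDiagSq_hadamard_le (hC : IsDephasing C q) (M : Matrix m m ℂ) :
    offDiagSq (C ⊙ M) ≤ q ^ 2 * offDiagSq M := by
  simp only [offDiagSq, Finset.mul_sum]
  refine Finset.sum_le_sum fun i _ => Finset.sum_le_sum fun j _ => ?_
  split_ifs with h
  · simp
  · rw [Matrix.hadamard_apply, norm_mul, mul_pow]
    have := hC.off i j h
    gcongr

lemma hsSq_hadamard_le (hC : IsDephasing C q) (hq0 : 0 ≤ q) (hq1 : q ≤ 1) (M : Matrix m m ℂ) :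
    hsSq (C ⊙ M) ≤ hsSq M := by
  have h1 := hC.offDiagSq_hadamard_le M
  have h2 : 0 ≤ offDiagSq M :=
    Finset.sum_nonneg fun _ _ => Finset.sum_nonneg fun _ _ => by positivity
  rw [← diagSq_add_offDiagSq, ← diagSq_add_offDiagSq, hC.diagSq_hadamard]
  nlinarith [pow_le_one₀ (n := 2) hq0 hq1]

/-- Dephasing in two mutually unbiased bases contracts traceless matrices. -/
theorem hsSq_unbiased_le {C' W : Matrix m m ℂ} {r : ℝ} (hC : IsDephasing C q)
    (hC' : IsDephasing C' q) (hq0 : 0 ≤ q) (hq1 : q ≤ 1)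
    (hW : W ∈ Matrix.unitaryGroup m ℂ) (hr : ∀ i j, ‖W i j‖ ^ 2 = r)
    {M : Matrix m m ℂ} (hM : M.trace = 0) :
    hsSq (C' ⊙ (Wᴴ * (C ⊙ M) * W)) ≤ q ^ 2 * hsSq M := by
  have hWs : Wᴴ ∈ Matrix.unitaryGroup m ℂ := conjTranspose_mem_unitaryGroup hW
  have hconj : ∀ A, hsSq (Wᴴ * A * W) = hsSq A := fun A => by
    simpa using hsSq_unitary_conj hWs A
  set O : Matrix m m ℂ := Matrix.of fun i j => if i = j then 0 else C i j * M i j with hO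
  have hsplit : C ⊙ M = Matrix.diagonal (fun i => M i i) + O := by
    ext i j
    by_cases h : i = j
    · subst h; simp [hO, hC.diag]
    · simp [hO, h]
  have hOsq : hsSq O = offDiagSq (C ⊙ M) := by
    refine Finset.sum_congr rfl fun i _ => Finset.sum_congr rfl fun j _ => ?_
    by_cases h : i = j <;> simp [hO, h]
  have hdiag : diagSq (Wᴴ * (C ⊙ M) * W) = diagSq (Wᴴ * O * W) := by
    refine Finset.sum_congr rfl fun k _ => ?_
    have h0 : (Wᴴ * Matrix.diagonal (fun i => M i i) * W) k k = 0 := by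
      have : ∀ i, star (W i k) * M i i * W i k = (r : ℂ) * M i i := fun i => by
        rw [mul_right_comm, ← hr i k]
        congr 1
        push_cast
        exact Complex.conj_mul' _
      rw [Matrix.mul_apply]
      simp only [Matrix.mul_diagonal, Matrix.conjTranspose_apply, this, ← Finset.mul_sum]
      rw [show ∑ i, M i i = 0 from hM, mul_zero]
    rw [hsplit, Matrix.mul_add, Matrix.add_mul, Matrix.add_apply, h0, zero_add]
  have h1 := hC'.offDiagSq_hadamard_le (Wᴴ * (C ⊙ M) * W)
  have h2 := hC'.diagSq_hadamard (Wᴴ * (C ⊙ M) * W)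
  have h3 := diagSq_add_offDiagSq (C' ⊙ (Wᴴ * (C ⊙ M) * W))
  have h4 := diagSq_add_offDiagSq (Wᴴ * (C ⊙ M) * W)
  have h5 := diagSq_add_offDiagSq (C ⊙ M)
  have h6 := diagSq_add_offDiagSq M
  have h7 := hC.diagSq_hadamard M
  have h8 := hC.offDiagSq_hadamard_le M
  have h9 := diagSq_le_hsSq (Wᴴ * O * W)
  rw [hconj] at h4 h9
  have h10 : q ^ 2 ≤ 1 := pow_le_one₀ hq0 hq1
  have h11 : (1 - q ^ 2) * diagSq (Wᴴ * O * W) ≤ (1 - q ^ 2) * hsSq O :=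
    mul_le_mul_of_nonneg_left h9 (by linarith)
  rw [hdiag] at h4 h2
  rw [hOsq] at h11
  nlinarith

end IsDephasing

end Dephasing

section Mean

variable {ι m : Type*}

/-- Entrywise expectation of a random matrix. -/
def matMean (P : Measure (ι → ℝ)) (F : (ι → ℝ) → Matrix m m ℂ) : Matrix m m ℂ :=
  Matrix.of fun i j => ∫ x, F x i j ∂P

/-- Random matrices with continuous bounded entries depending only on the coordinates in `S`. -/
structure IsLocal (F : (ι → ℝ) → Matrix m m ℂ) (S : Set ι) : Prop where
  cont : ∀ i j, Continuous fun x => F x i j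
  bdd : ∀ i j, ∃ C, ∀ x, ‖F x i j‖ ≤ C
  dep : DependsOn F S

namespace IsLocal

variable {F G : (ι → ℝ) → Matrix m m ℂ} {S T : Set ι}

lemma const (A : Matrix m m ℂ) (S : Set ι) : IsLocal (fun _ => A) S where
  cont _ _ := continuous_const
  bdd i j := ⟨‖A i j‖, fun _ => le_rfl⟩
  dep _ _ _ := rfl

lemma mono (hF : IsLocal F S) (h : S ⊆ T) : IsLocal F T :=
  ⟨hF.cont, hF.bdd, fun _ _ hxy => hF.dep fun i hi => hxy i (h hi)⟩

lemma mul [Fintype m] (hF : IsLocal F S) (hG : IsLocal G S) : IsLocal (fun x => F x * G x) S where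
  cont i j := by
    simp only [Matrix.mul_apply]
    exact continuous_finsetSum _ fun k _ => (hF.cont i k).mul (hG.cont k j)
  bdd i j := by
    choose C hC using hF.bdd
    choose D hD using hG.bdd
    refine ⟨∑ k, C i k * D k j, fun x => ?_⟩
    rw [Matrix.mul_apply]
    refine (norm_sum_le _ _).trans (Finset.sum_le_sum fun k _ => ?_)
    rw [norm_mul]
    exact mul_le_mul (hC i k x) (hD k j x) (norm_nonneg _) ((norm_nonneg _).trans (hC i k x))
  dep x y h := by
    dsimp only
    rw [hF.dep h, hG.dep h]

lemma conjTranspose (hF : IsLocal F S) : IsLocal (fun x => (F x)ᴴ) S where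
  cont i j := by
    simp only [Matrix.conjTranspose_apply]
    exact (hF.cont j i).star
  bdd i j := by
    obtain ⟨C, hC⟩ := hF.bdd j i
    exact ⟨C, fun x => by simpa using hC x⟩
  dep x y h := by
    dsimp only
    rw [hF.dep h]

lemma conj [Fintype m] (hF : IsLocal F S) (hG : IsLocal G S) : IsLocal (fun x => G x * F x * (G x)ᴴ) S :=
  (hG.mul hF).mul hG.conjTranspose

lemma integrable [Fintype ι] (hF : IsLocal F S) (P : Measure (ι → ℝ)) [IsFiniteMeasure P]
    (i j : m) : Integrable (fun x => F x i j) P := by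
  obtain ⟨C, hC⟩ := hF.bdd i j
  exact .of_bound (hF.cont i j).aestronglyMeasurable C (.of_forall hC)

lemma matMean_mul_mul [Fintype ι] [Fintype m] (hF : IsLocal F S) (P : Measure (ι → ℝ)) [IsFiniteMeasure P]
    (A B : Matrix m m ℂ) : matMean P (fun x => A * F x * B) = A * matMean P F * B := by
  ext i j
  simp only [matMean, Matrix.of_apply, Matrix.mul_apply, Finset.sum_mul]
  rw [integral_finsetSum _ fun k _ => integrable_finsetSum _ fun l _ =>
    ((hF.integrable P l k).const_mul _).mul_const _]
  refine Finset.sum_congr rfl fun k _ => ?_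
  rw [integral_finsetSum _ fun l _ => ((hF.integrable P l k).const_mul _).mul_const _]
  refine Finset.sum_congr rfl fun l _ => ?_
  rw [integral_mul_const, integral_const_mul]

lemma integral_trace_mul [Fintype ι] [Fintype m] (hF : IsLocal F S) (P : Measure (ι → ℝ))
    [IsFiniteMeasure P] (H : Matrix m m ℂ) :
    ∫ x, ((H * F x).trace).re ∂P = ((H * matMean P F).trace).re := by
  have hint : ∀ i j, Integrable (fun x => H i j * F x j i) P := fun i j =>
    (hF.integrable P j i).const_mul _
  simp only [Matrix.trace, Matrix.diag, Matrix.mul_apply, matMean, Matrix.of_apply]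
  have h := integral_re (𝕜 := ℂ) (μ := P) (f := fun x => ∑ i, ∑ j, H i j * F x j i)
    (integrable_finsetSum _ fun i _ => integrable_finsetSum _ fun j _ => hint i j)
  refine h.trans ?_
  rw [integral_finsetSum _ fun i _ => integrable_finsetSum _ fun j _ => hint i j]
  simp only [integral_finsetSum _ fun j _ => hint _ j, integral_const_mul]
  rfl

end IsLocal

lemma DependsOn.exists_measurable_comp {E : Type*} [MeasurableSpace E] {f : (ι → ℝ) → E}
    {S : Finset ι} (hfS : DependsOn f (S : Set ι)) (hf : Measurable f) :
    ∃ φ : (S → ℝ) → E, Measurable φ ∧ f = φ ∘ fun x (i : S) => x i := by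
  classical
  refine ⟨fun y => f fun i => if h : i ∈ S then y ⟨i, h⟩ else 0,
    hf.comp (measurable_pi_lambda _ fun i => ?_), ?_⟩
  · split_ifs <;> fun_prop
  · funext x
    refine hfS fun i hi => ?_
    simp [Finset.mem_coe.1 hi]

/-- Functions of disjoint sets of coordinates are independent under a product measure. -/
lemma indepFun_of_dependsOn [Fintype ι] {ν : ι → Measure ℝ} [∀ i, IsProbabilityMeasure (ν i)]
    {E E' : Type*} [MeasurableSpace E] [MeasurableSpace E'] {f : (ι → ℝ) → E} {g : (ι → ℝ) → E'}
    {S T : Set ι} (hST : Disjoint S T) (hf : Measurable f) (hg : Measurable g)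
    (hfS : DependsOn f S) (hgT : DependsOn g T) : IndepFun f g (Measure.pi ν) := by
  classical
  rw [← S.coe_toFinset] at hfS
  rw [← T.coe_toFinset] at hgT
  obtain ⟨φ, hφ, rfl⟩ := hfS.exists_measurable_comp hf
  obtain ⟨ψ, hψ, rfl⟩ := hgT.exists_measurable_comp hg
  have hind : iIndepFun (fun i (x : ι → ℝ) => x i) (Measure.pi ν) :=
    iIndepFun_pi (X := fun _ => id) fun _ => aemeasurable_id
  exact (hind.indepFun_finset S.toFinset T.toFinset (by simpa using hST)
    fun i => measurable_pi_apply i).comp hφ hψ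

end Mean

section Kron

variable {N : ℕ}

lemma kron_mul (A B : Fin N → Matrix (Fin 2) (Fin 2) ℂ) :
    kron (fun n => A n * B n) = kron A * kron B := by
  ext i j
  simp only [kron, Matrix.of_apply, Matrix.mul_apply, ← Finset.prod_mul_distrib]
  rw [Finset.prod_univ_sum, Fintype.piFinset_univ]

lemma kron_conjTranspose (A : Fin N → Matrix (Fin 2) (Fin 2) ℂ) :
    (kron A)ᴴ = kron fun n => (A n)ᴴ := by
  ext i j
  simp [kron, Matrix.conjTranspose_apply]

lemma kron_one : kron (fun _ : Fin N => (1 : Matrix (Fin 2) (Fin 2) ℂ)) = 1 := by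
  ext i j
  simp only [kron, Matrix.of_apply, Matrix.one_apply, Finset.prod_ite_zero, Finset.prod_const_one,
    Finset.mem_univ, true_implies, funext_iff]

lemma kron_diagonal (d : Fin N → Fin 2 → ℂ) :
    kron (fun n => Matrix.diagonal (d n)) = Matrix.diagonal fun a => ∏ n, d n (a n) := by
  ext i j
  simp only [kron, Matrix.of_apply, Matrix.diagonal_apply, Finset.prod_ite_zero,
    Finset.mem_univ, true_implies, funext_iff]

/-- The eigenbasis of the Pauli matrix `Y`. -/
def yBasis : Matrix (Fin 2) (Fin 2) ℂ :=
  ((Real.sqrt 2)⁻¹ : ℂ) • !![1, 1; Complex.I, -Complex.I]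

lemma sqrt_two_inv_mul_self : ((Real.sqrt 2 : ℂ)⁻¹) * (Real.sqrt 2 : ℂ)⁻¹ = 1 / 2 := by
  rw [← mul_inv, ← Complex.ofReal_mul, Real.mul_self_sqrt (by norm_num)]
  norm_num

lemma yBasis_mul_conjTranspose : yBasis * yBasisᴴ = 1 := by
  rw [yBasis, Matrix.conjTranspose_smul, Matrix.smul_mul, Matrix.mul_smul, smul_smul]
  have : star ((Real.sqrt 2 : ℂ)⁻¹) = (Real.sqrt 2 : ℂ)⁻¹ := by
    simp [Complex.conj_ofReal]
  rw [this, sqrt_two_inv_mul_self]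
  ext i j
  rw [Matrix.smul_apply, Matrix.mul_apply]
  fin_cases i <;> fin_cases j <;> simp <;> norm_num

lemma yBasis_mul_PZ : yBasis * PZ = PY * yBasis := by
  rw [yBasis, Matrix.smul_mul, Matrix.mul_smul]
  congr 1
  ext i j
  fin_cases i <;> fin_cases j <;> simp [PZ, PY]

lemma Ry_eq (x : ℝ) : Ry x = yBasis * Rz x * yBasisᴴ := by
  simp only [Ry, Rz, rotG, Matrix.mul_sub, Matrix.sub_mul, Matrix.mul_smul, Matrix.smul_mul,
    Matrix.mul_one, yBasis_mul_conjTranspose, yBasis_mul_PZ]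
  rw [Matrix.mul_assoc, yBasis_mul_conjTranspose, Matrix.mul_one]

lemma norm_yBasis_sq (i j : Fin 2) : ‖yBasis i j‖ ^ 2 = 1 / 2 := by
  fin_cases i <;> fin_cases j <;> simp [yBasis]

/-- The tensor power of `yBasis`. -/
def yKron (N : ℕ) : Matrix (Fin N → Fin 2) (Fin N → Fin 2) ℂ := kron fun _ => yBasis

lemma yKron_mem_unitaryGroup : yKron N ∈ Matrix.unitaryGroup (Fin N → Fin 2) ℂ := by
  rw [Matrix.mem_unitaryGroup_iff, Matrix.star_eq_conjTranspose, yKron, kron_conjTranspose,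
    ← kron_mul]
  simp only [yBasis_mul_conjTranspose, kron_one]

lemma norm_yKron_sq (i j : Fin N → Fin 2) : ‖yKron N i j‖ ^ 2 = (1 / 2) ^ N := by
  simp [yKron, kron, norm_prod, ← Finset.prod_pow, norm_yBasis_sq]

lemma layerGate_eq (x : Fin N → Fin 3 → ℝ) :
    layerGate x = kron (fun n => Rz (x n 2)) *
      (yKron N * kron (fun n => Rz (x n 1)) * (yKron N)ᴴ) * kron fun n => Rz (x n 0) := by
  simp only [layerGate, encGate, Ry_eq, yKron, kron_conjTranspose, kron_mul]

/-- Half the `Z` eigenvalue, up to sign: the angular frequency of the diagonal of `Rz`. -/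
def zFreq (i : Fin 2) : ℝ := if i = 0 then -(1 / 2) else 1 / 2

lemma Rz_eq_diagonal (x : ℝ) :
    Rz x = Matrix.diagonal fun i => Complex.exp (zFreq i * x * Complex.I) := by
  have h : ∀ t : ℝ, Complex.exp (t * Complex.I) = Real.cos t + Real.sin t * Complex.I := by
    intro t
    rw [Complex.exp_mul_I, Complex.ofReal_cos, Complex.ofReal_sin]
  have h' : ∀ i, Complex.exp (zFreq i * x * Complex.I) =
      Real.cos (zFreq i * x) + Real.sin (zFreq i * x) * Complex.I := fun i => by
    rw [← h]; push_cast; rfl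
  simp only [h', Rz, rotG, PZ]
  have e : (1 / 2 : ℝ) * x = x / 2 := by ring
  ext i j
  fin_cases i <;> fin_cases j <;>
    simp [zFreq, -one_div, e, Real.cos_neg, Real.sin_neg,
      -Complex.ofReal_cos, -Complex.ofReal_sin] <;> ring

end Kron

section RandomPhases

variable {N : ℕ} {ι : Type*}

lemma integral_exp_gaussianReal (μ : ℝ) (v : ℝ≥0) (t : ℝ) :
    ‖∫ x, Complex.exp (t * x * Complex.I) ∂gaussianReal μ v‖ = Real.exp (-(v * t ^ 2 / 2)) := by
  rw [← charFun_apply_real, charFun_gaussianReal, Complex.norm_exp]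
  congr 1
  have : ((t : ℂ) * μ * Complex.I - v * t ^ 2 / 2) =
      ((-(v * t ^ 2 / 2) : ℝ) : ℂ) + ((t * μ : ℝ) : ℂ) * Complex.I := by
    push_cast; ring
  rw [this, Complex.add_re, Complex.ofReal_re, Complex.re_ofReal_mul, Complex.I_re, mul_zero,
    add_zero]

/-- The factor by which conjugation with `⊗ₙ Rz (y n)` multiplies the entry `(a, b)`. -/
def zPhase (y : Fin N → ℝ) : Matrix (Fin N → Fin 2) (Fin N → Fin 2) ℂ :=
  Matrix.of fun a b =>
    ∏ n, Complex.exp (((zFreq (a n) - zFreq (b n) : ℝ) : ℂ) * y n * Complex.I)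

lemma kron_Rz_conj (y : Fin N → ℝ) (M : Matrix (Fin N → Fin 2) (Fin N → Fin 2) ℂ) :
    kron (fun n => Rz (y n)) * M * (kron fun n => Rz (y n))ᴴ = zPhase y ⊙ M := by
  ext a b
  simp only [Rz_eq_diagonal, kron_diagonal, Matrix.diagonal_conjTranspose, Matrix.mul_diagonal,
    Matrix.diagonal_mul, Matrix.hadamard_apply, zPhase, Matrix.of_apply, Pi.star_apply, star_prod]
  rw [mul_right_comm, ← Finset.prod_mul_distrib]
  congr 1
  refine Finset.prod_congr rfl fun n _ => ?_
  rw [Complex.star_def, ← Complex.exp_conj, ← Complex.exp_add]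
  congr 1
  simp only [map_mul, Complex.conj_ofReal, Complex.conj_I]
  push_cast
  ring

lemma isLocal_kron_Rz (a : Fin N → ι) :
    IsLocal (fun x : ι → ℝ => kron fun n => Rz (x (a n))) (Set.range a) where
  cont i j := by
    simp only [kron, Rz_eq_diagonal, Matrix.of_apply, Matrix.diagonal_apply]
    refine continuous_finsetProd _ fun n _ => ?_
    split_ifs <;> fun_prop
  bdd i j := by
    refine ⟨1, fun x => ?_⟩
    simp only [kron, Rz_eq_diagonal, Matrix.of_apply, Matrix.diagonal_apply, norm_prod]
    refine Finset.prod_le_one (fun _ _ => norm_nonneg _) fun n _ => ?_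
    split_ifs
    · rw [← Complex.ofReal_mul, Complex.norm_exp_ofReal_mul_I]
    · simp
  dep x y h := by
    have : ∀ n, x (a n) = y (a n) := fun n => h _ ⟨n, rfl⟩
    simp only [this]

lemma dephasing_of_gaussian [Fintype ι] {μ : ι → ℝ} {v : ι → ℝ≥0} {σ2 : ℝ}
    (hv : ∀ i, σ2 ≤ v i) {a : Fin N → ι} (ha : Function.Injective a)
    {F : (ι → ℝ) → Matrix (Fin N → Fin 2) (Fin N → Fin 2) ℂ} {S : Set ι} (hF : IsLocal F S)
    (hS : Disjoint (Set.range a) S) :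
    ∃ C, IsDephasing C (Real.exp (-(σ2 / 2))) ∧
      matMean (Measure.pi fun i => gaussianReal (μ i) (v i))
        (fun x => kron (fun n => Rz (x (a n))) * F x * (kron fun n => Rz (x (a n)))ᴴ) =
      C ⊙ matMean (Measure.pi fun i => gaussianReal (μ i) (v i)) F := by
  set P := Measure.pi fun i => gaussianReal (μ i) (v i) with hP
  have hcont : ∀ i j, Continuous fun x : ι → ℝ => zPhase (fun n => x (a n)) i j := fun i j => by
    simp only [zPhase, Matrix.of_apply]
    fun_prop
  have hind : iIndepFun (fun n (x : ι → ℝ) => x (a n)) P :=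
    (iIndepFun_pi (X := fun _ => id) fun _ => aemeasurable_id).precomp ha
  have hint : ∀ i j, matMean P (fun x => zPhase fun n => x (a n)) i j =
      ∏ n, ∫ x, Complex.exp (((zFreq (i n) - zFreq (j n) : ℝ) : ℂ) * x * Complex.I)
        ∂gaussianReal (μ (a n)) (v (a n)) := fun i j => by
    simp only [matMean, zPhase, Matrix.of_apply]
    rw [hind.integral_fun_prod_comp
      (f := fun n (x : ℝ) => Complex.exp (((zFreq (i n) - zFreq (j n) : ℝ) : ℂ) * x * Complex.I))
      (fun n => (measurable_pi_apply _).aemeasurable)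
      (fun n => Continuous.aestronglyMeasurable (by fun_prop))]
    refine Finset.prod_congr rfl fun n _ => ?_
    rw [← (measurePreserving_eval (fun i => gaussianReal (μ i) (v i)) (a n)).map_eq,
      integral_map (measurable_pi_apply _).aemeasurable
        (Continuous.aestronglyMeasurable (by fun_prop))]
  refine ⟨matMean P fun x => zPhase fun n => x (a n), ⟨fun i => ?_, fun i j hij => ?_⟩, ?_⟩
  · rw [hint]
    simp
  · rw [hint, norm_prod]
    simp only [integral_exp_gaussianReal]
    obtain ⟨n, hn⟩ := Function.ne_iff.1 hij
    rw [← Finset.mul_prod_erase _ _ (Finset.mem_univ n)]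
    refine (mul_le_of_le_one_right (Real.exp_nonneg _)
      (Finset.prod_le_one (fun _ _ => Real.exp_nonneg _) fun k _ => ?_)).trans ?_
    · rw [Real.exp_le_one_iff, neg_nonpos]
      positivity
    · have : (zFreq (i n) - zFreq (j n)) ^ 2 = 1 := by
        generalize i n = p at hn
        generalize j n = r at hn
        fin_cases p <;> fin_cases r <;> first | exact absurd rfl hn | norm_num [zFreq]
      rw [this, Real.exp_le_exp]
      have := hv (a n)
      linarith
  · ext i j
    simp only [kron_Rz_conj, Matrix.hadamard_apply]
    refine (IndepFun.integral_fun_mul_eq_mul_integral (indepFun_of_dependsOn hS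
      (hcont i j).measurable (hF.cont i j).measurable ?_ ?_)
      (hcont i j).aestronglyMeasurable (hF.cont i j).aestronglyMeasurable)
    · intro x y h
      have : ∀ n, x (a n) = y (a n) := fun n => h _ ⟨n, rfl⟩
      simp only [this]
    · intro x y h
      dsimp only
      rw [hF.dep h]

end RandomPhases

section Layer

variable {m : Type*} [Fintype m] [DecidableEq m]

/-- The averaged action of an encoding layer: dephasing in the basis `1`, then `W`, then `1`,
followed by conjugation with `U`. -/
def layerMap (U W C₀ C₁ C₂ M : Matrix m m ℂ) : Matrix m m ℂ :=
  U * (C₂ ⊙ (W * (C₁ ⊙ (Wᴴ * (C₀ ⊙ M) * W)) * Wᴴ)) * Uᴴ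

variable {U W C₀ C₁ C₂ : Matrix m m ℂ} {q : ℝ}

lemma trace_layerMap (hU : U ∈ Matrix.unitaryGroup m ℂ) (hW : W ∈ Matrix.unitaryGroup m ℂ)
    (h₀ : IsDephasing C₀ q) (h₁ : IsDephasing C₁ q) (h₂ : IsDephasing C₂ q) (M : Matrix m m ℂ) :
    (layerMap U W C₀ C₁ C₂ M).trace = M.trace := by
  have hW' := trace_unitary_conj (conjTranspose_mem_unitaryGroup hW) (C₀ ⊙ M)
  rw [Matrix.conjTranspose_conjTranspose] at hW'
  rw [layerMap, trace_unitary_conj hU, h₂.trace_hadamard, trace_unitary_conj hW,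
    h₁.trace_hadamard, hW', h₀.trace_hadamard]

lemma layerMap_sub_smul_one (hU : U ∈ Matrix.unitaryGroup m ℂ)
    (hW : W ∈ Matrix.unitaryGroup m ℂ) (h₀ : IsDephasing C₀ q) (h₁ : IsDephasing C₁ q)
    (h₂ : IsDephasing C₂ q) (M : Matrix m m ℂ) (c : ℂ) :
    layerMap U W C₀ C₁ C₂ (M - c • 1) = layerMap U W C₀ C₁ C₂ M - c • 1 := by
  have hU₁ : U * Uᴴ = 1 := Matrix.mem_unitaryGroup_iff.1 hU
  have hW₁ : W * Wᴴ = 1 := Matrix.mem_unitaryGroup_iff.1 hW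
  have hW₂ : Wᴴ * W = 1 := Matrix.mem_unitaryGroup_iff'.1 hW
  have hsub : ∀ {C : Matrix m m ℂ}, IsDephasing C q → ∀ A,
      C ⊙ (A - c • 1) = C ⊙ A - c • 1 := fun {C} hC A => by
    have h : C ⊙ (A - c • 1) = C ⊙ A - c • (C ⊙ 1) := by
      ext i j
      simp [mul_sub, mul_left_comm]
    rw [h, hC.hadamard_one]
  simp only [layerMap, hsub h₀, hsub h₁, hsub h₂, Matrix.mul_sub, Matrix.sub_mul,
    Matrix.mul_smul, Matrix.smul_mul, Matrix.mul_one, hU₁, hW₁, hW₂]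

lemma hsSq_layerMap_le {r : ℝ} (hU : U ∈ Matrix.unitaryGroup m ℂ)
    (hW : W ∈ Matrix.unitaryGroup m ℂ) (hr : ∀ i j, ‖W i j‖ ^ 2 = r)
    (h₀ : IsDephasing C₀ q) (h₁ : IsDephasing C₁ q) (h₂ : IsDephasing C₂ q)
    (hq0 : 0 ≤ q) (hq1 : q ≤ 1) {M : Matrix m m ℂ} (hM : M.trace = 0) :
    hsSq (layerMap U W C₀ C₁ C₂ M) ≤ q ^ 2 * hsSq M := by
  rw [layerMap, hsSq_unitary_conj hU]
  refine (h₂.hsSq_hadamard_le hq0 hq1 _).trans ?_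
  rw [hsSq_unitary_conj hW]
  exact h₀.hsSq_unbiased_le h₁ hq0 hq1 hW hr hM

end Layer

section Circuit

variable {N : ℕ} {ι : Type*}

lemma isLocal_layer (U : Matrix (Fin N → Fin 2) (Fin N → Fin 2) ℂ) (a : Fin N → Fin 3 → ι) :
    IsLocal (fun x : ι → ℝ => U * layerGate fun n i => x (a n i)) {p | ∃ n i, a n i = p} := by
  have h : ∀ i, IsLocal (fun x : ι → ℝ => kron fun n => Rz (x (a n i)))
      {p | ∃ n i, a n i = p} := fun i =>
    (isLocal_kron_Rz fun n => a n i).mono fun p ⟨n, hn⟩ => ⟨n, i, hn⟩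
  simp only [layerGate_eq]
  exact (IsLocal.const U _).mul (((h 2).mul (((IsLocal.const _ _).mul (h 1)).mul
    (IsLocal.const _ _))).mul (h 0))

variable [Fintype ι] {μ : ι → ℝ} {v : ι → ℝ≥0} {σ2 : ℝ}

lemma exists_layerMap_of_gaussian (hv : ∀ i, σ2 ≤ v i) {a : Fin N → Fin 3 → ι} (ha : Function.Injective2 a)
    {F : (ι → ℝ) → Matrix (Fin N → Fin 2) (Fin N → Fin 2) ℂ} {S : Set ι} (hF : IsLocal F S) (hS : ∀ n i, a n i ∉ S)
    (U : Matrix (Fin N → Fin 2) (Fin N → Fin 2) ℂ) :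
    ∃ C₀ C₁ C₂, IsDephasing C₀ (Real.exp (-(σ2 / 2))) ∧ IsDephasing C₁ (Real.exp (-(σ2 / 2))) ∧
      IsDephasing C₂ (Real.exp (-(σ2 / 2))) ∧
      matMean (Measure.pi fun i => gaussianReal (μ i) (v i))
        (fun x => (U * layerGate fun n i => x (a n i)) * F x *
          (U * layerGate fun n i => x (a n i))ᴴ) =
      layerMap U (yKron N) C₀ C₁ C₂
        (matMean (Measure.pi fun i => gaussianReal (μ i) (v i)) F) := by
  set P := Measure.pi fun i => gaussianReal (μ i) (v i) with hP
  set Z : Fin 3 → (ι → ℝ) → Matrix (Fin N → Fin 2) (Fin N → Fin 2) ℂ :=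
    fun i x => kron fun n => Rz (x (a n i)) with hZ
  set R : Fin 3 → Set ι := fun i => Set.range fun n => a n i with hR
  have hinj : ∀ i, Function.Injective fun n => a n i := fun i _ _ h => (ha h).1
  have hRR : ∀ i j, i ≠ j → Disjoint (R i) (R j) := fun i j hij => by
    rw [Set.disjoint_left]
    rintro _ ⟨n, rfl⟩ ⟨k, hk⟩
    exact hij (ha hk).2.symm
  have hRS : ∀ i, Disjoint (R i) S := fun i => by
    rw [Set.disjoint_left]
    rintro _ ⟨n, rfl⟩
    exact hS n i
  have hZl : ∀ i, IsLocal (Z i) (R i) := fun i => isLocal_kron_Rz fun n => a n i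
  have hF₀ : IsLocal (fun x => Z 0 x * F x * (Z 0 x)ᴴ) (S ∪ R 0) :=
    (hF.mono Set.subset_union_left).conj ((hZl 0).mono Set.subset_union_right)
  have hF₀' : IsLocal (fun x => (yKron N)ᴴ * (Z 0 x * F x * (Z 0 x)ᴴ) * yKron N) (S ∪ R 0) :=
    ((IsLocal.const _ _).mul hF₀).mul (IsLocal.const _ _)
  have hF₁ : IsLocal (fun x => Z 1 x * ((yKron N)ᴴ * (Z 0 x * F x * (Z 0 x)ᴴ) * yKron N) *
      (Z 1 x)ᴴ) (S ∪ R 0 ∪ R 1) :=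
    (hF₀'.mono Set.subset_union_left).conj ((hZl 1).mono Set.subset_union_right)
  have hF₁' : IsLocal (fun x => yKron N * (Z 1 x * ((yKron N)ᴴ * (Z 0 x * F x * (Z 0 x)ᴴ) *
      yKron N) * (Z 1 x)ᴴ) * (yKron N)ᴴ) (S ∪ R 0 ∪ R 1) :=
    ((IsLocal.const _ _).mul hF₁).mul (IsLocal.const _ _)
  have hF₂ : IsLocal (fun x => Z 2 x * (yKron N * (Z 1 x * ((yKron N)ᴴ *
      (Z 0 x * F x * (Z 0 x)ᴴ) * yKron N) * (Z 1 x)ᴴ) * (yKron N)ᴴ) * (Z 2 x)ᴴ)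
      (S ∪ R 0 ∪ R 1 ∪ R 2) :=
    (hF₁'.mono Set.subset_union_left).conj ((hZl 2).mono Set.subset_union_right)
  have hd₁ : Disjoint (R 1) (S ∪ R 0) :=
    Set.disjoint_union_right.2 ⟨hRS 1, hRR 1 0 (by decide)⟩
  have hd₂ : Disjoint (R 2) (S ∪ R 0 ∪ R 1) :=
    Set.disjoint_union_right.2 ⟨Set.disjoint_union_right.2 ⟨hRS 2, hRR 2 0 (by decide)⟩,
      hRR 2 1 (by decide)⟩
  obtain ⟨C₀, h₀, e₀⟩ := dephasing_of_gaussian (μ := μ) hv (hinj 0) hF (hRS 0)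
  obtain ⟨C₁, h₁, e₁⟩ := dephasing_of_gaussian (μ := μ) hv (hinj 1) hF₀' hd₁
  obtain ⟨C₂, h₂, e₂⟩ := dephasing_of_gaussian (μ := μ) hv (hinj 2) hF₁' hd₂
  refine ⟨C₀, C₁, C₂, h₀, h₁, h₂, ?_⟩
  have hG : ∀ x, (U * layerGate fun n i => x (a n i)) * F x *
      (U * layerGate fun n i => x (a n i))ᴴ = U * (Z 2 x * (yKron N * (Z 1 x * ((yKron N)ᴴ *
      (Z 0 x * F x * (Z 0 x)ᴴ) * yKron N) * (Z 1 x)ᴴ) * (yKron N)ᴴ) * (Z 2 x)ᴴ) * Uᴴ := fun x => by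
    simp only [layerGate_eq, hZ, Matrix.conjTranspose_mul, Matrix.conjTranspose_conjTranspose,
      Matrix.mul_assoc]
  simp only [hG]
  rw [hF₂.matMean_mul_mul P, e₂, hF₁.matMean_mul_mul P, e₁, hF₀.matMean_mul_mul P, e₀, layerMap]

lemma rho0_apply (i j : Fin N → Fin 2) : rho0 N i j = if i = 0 ∧ j = 0 then 1 else 0 := by
  have h : ∀ p q : Fin 2, ket0 p q = if p = 0 ∧ q = 0 then 1 else 0 := by
    intro p q
    fin_cases p <;> fin_cases q <;> simp [ket0]
  simp only [rho0, kron, Matrix.of_apply, h, Finset.prod_ite_zero, Finset.prod_const_one,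
    Finset.mem_univ, true_implies, forall_and, funext_iff, Pi.zero_apply]

lemma trace_rho0 : (rho0 N).trace = 1 := by
  simp [Matrix.trace, rho0_apply]

lemma hsSq_sub_smul_one_le {m : Type*} [Fintype m] [DecidableEq m] [Nonempty m]
    {M : Matrix m m ℂ} (hM : M.trace = 1) :
    hsSq (M - (Fintype.card m : ℂ)⁻¹ • 1) ≤ hsSq M := by
  have hc : (Fintype.card m : ℂ) ≠ 0 := by exact_mod_cast Fintype.card_ne_zero
  have hM' : Mᴴ.trace = 1 := by rw [Matrix.trace_conjTranspose, hM, star_one]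
  have h : ((hsSq (M - (Fintype.card m : ℂ)⁻¹ • 1) : ℝ) : ℂ) =
      ((hsSq M - (Fintype.card m : ℝ)⁻¹ : ℝ) : ℂ) := by
    push_cast
    rw [hsSq_eq_trace, hsSq_eq_trace]
    simp only [Matrix.conjTranspose_sub, Matrix.conjTranspose_smul, Matrix.conjTranspose_one,
      Matrix.sub_mul, Matrix.mul_sub, Matrix.smul_mul, Matrix.mul_smul, Matrix.one_mul,
      Matrix.mul_one, Matrix.trace_sub, Matrix.trace_smul, Matrix.trace_one, hM, hM', smul_eq_mul,
      star_inv₀, star_natCast]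
    field_simp
    ring
  have h' := Complex.ofReal_injective h
  rw [h', sub_le_self_iff]
  positivity

lemma hsSq_rho0 : hsSq (rho0 N) = 1 := by
  have h : ∀ i j : Fin N → Fin 2,
      ‖rho0 N i j‖ ^ 2 = if i = 0 then (if j = 0 then 1 else 0) else 0 := fun i j => by
    rw [rho0_apply]
    by_cases hi : i = 0 <;> by_cases hj : j = 0 <;> simp [hi, hj]
  simp only [hsSq, h]
  simp

lemma reverse_prod_take_succ {M : Type*} [Monoid M] {L : ℕ} (f : Fin L → M) {k : ℕ} (hk : k < L) :
    ((List.ofFn f).take (k + 1)).reverse.prod =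
      f ⟨k, hk⟩ * ((List.ofFn f).take k).reverse.prod := by
  rw [List.take_succ_eq_append_getElem (by simpa using hk)]
  simp

end Circuit

/-- The averaged state after `k` encoding layers approaches the maximally mixed state
geometrically in Hilbert–Schmidt norm. -/
theorem hsSq_matMean_circuit_le {N L : ℕ} {μ : Fin L × Fin N × Fin 3 → ℝ}
    {v : Fin L × Fin N × Fin 3 → ℝ≥0} {σ2 : ℝ} (hσ2 : 0 < σ2) (hv : ∀ p, σ2 ≤ v p)
    {U : Fin L → Matrix (Fin N → Fin 2) (Fin N → Fin 2) ℂ}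
    (hU : ∀ l, U l ∈ Matrix.unitaryGroup (Fin N → Fin 2) ℂ)
    {Q : ℕ → (Fin L × Fin N × Fin 3 → ℝ) → Matrix (Fin N → Fin 2) (Fin N → Fin 2) ℂ}
    (hQ : ∀ k x, Q k x = ((List.ofFn fun l : Fin L =>
      U l * layerGate fun n i => x (l, n, i)).take k).reverse.prod) (k : ℕ) (hk : k ≤ L) :
    IsLocal (fun x => Q k x * rho0 N * (Q k x)ᴴ) {p | p.1.val < k} ∧
    (matMean (Measure.pi fun p => gaussianReal (μ p) (v p))
      fun x => Q k x * rho0 N * (Q k x)ᴴ).trace = 1 ∧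
    hsSq (matMean (Measure.pi fun p => gaussianReal (μ p) (v p))
      (fun x => Q k x * rho0 N * (Q k x)ᴴ) - (Fintype.card (Fin N → Fin 2) : ℂ)⁻¹ • 1) ≤
      Real.exp (-σ2) ^ k := by
  induction k with
  | zero =>
    have h : ∀ x, Q 0 x * rho0 N * (Q 0 x)ᴴ = rho0 N := fun x => by simp [hQ]
    simp only [h]
    have hm : matMean (Measure.pi fun p => gaussianReal (μ p) (v p))
        (fun _ => rho0 N) = rho0 N := by
      ext i j
      simp [matMean]
    rw [hm, pow_zero]
    exact ⟨IsLocal.const _ _, trace_rho0, (hsSq_sub_smul_one_le trace_rho0).trans hsSq_rho0.le⟩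
  | succ k ih =>
    obtain ⟨hloc, htr, hle⟩ := ih (by omega)
    have hlt : k < L := hk
    set a : Fin N → Fin 3 → Fin L × Fin N × Fin 3 := fun n i => (⟨k, hlt⟩, n, i) with ha
    set G : (Fin L × Fin N × Fin 3 → ℝ) → Matrix (Fin N → Fin 2) (Fin N → Fin 2) ℂ :=
      fun x => U ⟨k, hlt⟩ * layerGate fun n i => x (a n i) with hG
    have hstep : ∀ x, Q (k + 1) x * rho0 N * (Q (k + 1) x)ᴴ =
        G x * (Q k x * rho0 N * (Q k x)ᴴ) * (G x)ᴴ := fun x => by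
      rw [show Q (k + 1) x = G x * Q k x by rw [hQ, hQ, reverse_prod_take_succ _ hlt]]
      simp only [Matrix.conjTranspose_mul, Matrix.mul_assoc]
    simp only [hstep]
    have hinj : Function.Injective2 a := fun n n' i i' h => by simpa [ha] using h
    obtain ⟨C₀, C₁, C₂, h₀, h₁, h₂, e⟩ := exists_layerMap_of_gaussian (μ := μ) hv hinj hloc
      (fun n i => by simp [ha]) (U ⟨k, hlt⟩)
    rw [e]
    refine ⟨?_, ?_, ?_⟩
    · refine (hloc.mono fun p hp => ?_).conj ((isLocal_layer (U ⟨k, hlt⟩) a).mono ?_)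
      · exact Nat.lt_succ_of_lt hp
      · rintro _ ⟨n, i, rfl⟩
        exact Nat.lt_succ_self k
    · rw [trace_layerMap (hU _) yKron_mem_unitaryGroup h₀ h₁ h₂, htr]
    · rw [← layerMap_sub_smul_one (hU _) yKron_mem_unitaryGroup h₀ h₁ h₂, pow_succ']
      refine (hsSq_layerMap_le (hU _) yKron_mem_unitaryGroup norm_yKron_sq h₀ h₁ h₂
        (Real.exp_nonneg _) (Real.exp_le_one_iff.2 (by linarith)) ?_).trans ?_
      · have hc : (Fintype.card (Fin N → Fin 2) : ℂ) ≠ 0 := by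
          exact_mod_cast Fintype.card_ne_zero
        rw [Matrix.trace_sub, htr, Matrix.trace_smul, Matrix.trace_one, smul_eq_mul,
          inv_mul_cancel₀ hc, sub_self]
      · rw [← Real.exp_nat_mul, show ((2 : ℕ) : ℝ) * (-(σ2 / 2)) = -σ2 by push_cast; ring]
        exact mul_le_mul_of_nonneg_left hle (Real.exp_nonneg _)

lemma exp_neg_pow_le_of_layers {N L : ℕ} {σ2 ε : ℝ} (hσ2 : 0 < σ2) (hε : 0 < ε)
    (h : (1 / σ2) * (((N : ℝ) + 2) * Real.log 2 + 2 * Real.log (1 / ε)) ≤ (L : ℝ)) :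
    2 ^ N * Real.exp (-σ2) ^ L ≤ ε ^ 2 := by
  rw [one_div_mul_eq_div, div_le_iff₀ hσ2, one_div, Real.log_inv] at h
  have h2 : 0 < Real.log 2 := Real.log_pos one_lt_two
  have e1 : (2 : ℝ) ^ N = Real.exp (N * Real.log 2) := by
    rw [Real.exp_nat_mul, Real.exp_log two_pos]
  have e2 : ε ^ 2 = Real.exp ((2 : ℕ) * Real.log ε) := by
    rw [Real.exp_nat_mul, Real.exp_log hε]
  rw [e1, e2, ← Real.exp_nat_mul, ← Real.exp_add, Real.exp_le_exp]
  push_cast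
  linarith

/-- For an `N`-qubit data re-uploading circuit with `L` encoding layers
(no repetition) and independent Gaussian data with variances at least `σ² > 0`, if
`L ≥ (1/σ²)·((N+2)·ln 2 + 2·ln(1/ε))` then the expected output of any observable `H`
with eigenvalues in `[−1,1]` is within `ε` of its value `Tr[H]/2^N` on the maximally
mixed state. -/
theorem statement1
    (N L : ℕ) (hN : 1 ≤ N) (hL : 1 ≤ L)
    (μ : Fin L → Fin N → Fin 3 → ℝ) (v : Fin L → Fin N → Fin 3 → ℝ≥0)
    (σ2 : ℝ) (hσ2 : 0 < σ2) (hv : ∀ l n i, σ2 ≤ (v l n i : ℝ))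
    (U : Fin L → Matrix (Fin N → Fin 2) (Fin N → Fin 2) ℂ)
    (hU : ∀ l, U l ∈ Matrix.unitaryGroup (Fin N → Fin 2) ℂ)
    (H : Matrix (Fin N → Fin 2) (Fin N → Fin 2) ℂ)
    (hH : H.IsHermitian) (hEig : ∀ i, hH.eigenvalues i ∈ Set.Icc (-1 : ℝ) 1)
    (ε : ℝ) (hε : ε ∈ Set.Ioo (0 : ℝ) 1)
    (hLbound : (1 / σ2) * (((N : ℝ) + 2) * Real.log 2 + 2 * Real.log (1 / ε)) ≤ (L : ℝ))
    -- the product Gaussian measure on the data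
    (μx : Measure (Fin L × Fin N × Fin 3 → ℝ))
    (hμx : μx = Measure.pi fun p => gaussianReal (μ p.1 p.2.1 p.2.2) (v p.1 p.2.1 p.2.2))
    -- the data re-uploading circuit `V(x) = U_L R_L(x_{[L]}) ⋯ U_1 R_1(x_{[1]})`
    (V : (Fin L × Fin N × Fin 3 → ℝ) → Matrix (Fin N → Fin 2) (Fin N → Fin 2) ℂ)
    (hV : ∀ x, V x =
      (List.ofFn fun l : Fin L => U l * layerGate fun n i => x (l, n, i)).reverse.prod) :
    |(∫ x, ((H * (V x * rho0 N * (V x)ᴴ)).trace).re ∂μx) - (H.trace).re / (2 : ℝ) ^ N|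
      ≤ ε := by
  set Q : ℕ → (Fin L × Fin N × Fin 3 → ℝ) → Matrix (Fin N → Fin 2) (Fin N → Fin 2) ℂ :=
    fun k x => ((List.ofFn fun l : Fin L =>
      U l * layerGate fun n i => x (l, n, i)).take k).reverse.prod with hQ
  have hVQ : ∀ x, V x = Q L x := fun x => by
    rw [hV, hQ]
    dsimp only
    rw [List.take_of_length_le (by simp)]
  obtain ⟨hloc, -, hle⟩ := hsSq_matMean_circuit_le (μ := fun p => μ p.1 p.2.1 p.2.2)
    (v := fun p => v p.1 p.2.1 p.2.2) hσ2 (fun p => hv _ _ _) hU (Q := Q) (fun _ _ => rfl) L le_rfl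
  have hcard : Fintype.card (Fin N → Fin 2) = 2 ^ N := by simp
  simp only [hVQ, hμx]
  rw [hloc.integral_trace_mul]
  set A := matMean (Measure.pi fun p : Fin L × Fin N × Fin 3 =>
    gaussianReal (μ p.1 p.2.1 p.2.2) (v p.1 p.2.1 p.2.2)) fun x => Q L x * rho0 N * (Q L x)ᴴ
  have hsub : ((H * A).trace).re - (H.trace).re / (2 : ℝ) ^ N =
      ((H * (A - (Fintype.card (Fin N → Fin 2) : ℂ)⁻¹ • 1)).trace).re := by
    have hc : ((Fintype.card (Fin N → Fin 2) : ℂ))⁻¹ = (((2 : ℝ) ^ N)⁻¹ : ℝ) := by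
      rw [hcard]; push_cast; rfl
    rw [Matrix.mul_sub, Matrix.mul_smul, Matrix.mul_one, Matrix.trace_sub, Matrix.trace_smul, hc,
      smul_eq_mul, Complex.sub_re, Complex.re_ofReal_mul]
    ring
  rw [hsub]
  refine (Complex.abs_re_le_norm _).trans (abs_le_of_sq_le_sq' ?_ hε.1.le).2
  refine (norm_trace_mul_sq_le _ _).trans ?_
  have hHsq := hsSq_le_card_of_eigenvalues hH hEig
  rw [hcard] at hHsq
  push_cast at hHsq
  exact (mul_le_mul hHsq hle (hsSq_nonneg _) (by positivity)).trans
    (exp_neg_pow_le_of_layers hσ2 hε.1 hLbound)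
end
end

section
/- Let x = (x₁, x₂, x₃) have independent real Gaussian entries x_i ~ N(μ_i, σ_i²), let A_i = e^{−σ_i²/2}, and let R(x) = R_z(x₃) R_y(x₂) R_z(x₁) be the single-qubit encoding gate. Define the 3×3 real matrix 𝒯 whose entry in row b and column a (for a, b ranging over the ordered non-identity Pauli basis (Z, X, Y)) is (1/2)·E[Tr[σ_b R(x) σ_a R(x)†]]. Then 𝒯 = [[t_zz, t_xz, t_yz], [t_zx, t_xx, t_yx], [t_zy, t_xy, t_yy]] with t_zz = A₂cos(μ₂); t_zx = A₂sin(μ₂)A₃cos(μ₃); t_zy = A₂sin(μ₂)A₃sin(μ₃); t_xz = −A₂sin(μ₂)A₁cos(μ₁); t_xx = A₂cos(μ₂)A₁cos(μ₁)A₃cos(μ₃) − A₁sin(μ₁)A₃sin(μ₃); t_xy = A₂cos(μ₂)A₁cos(μ₁)A₃sin(μ₃) + A₁sin(μ₁)A₃cos(μ₃); t_yz = A₂sin(μ₂)A₁sin(μ₁); t_yx = −A₂cos(μ₂)A₁sin(μ₁)A₃cos(μ₃) − A₁cos(μ₁)A₃sin(μ₃); t_yy = −A₂cos(μ₂)A₁sin(μ₁)A₃sin(μ₃)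 + A₁cos(μ₁)A₃cos(μ₃). Moreover the full 4×4 expected transfer matrix of R(x) in the ordered basis (I,Z,X,Y) equals diag(1, 𝒯). -/
open Matrix MeasureTheory ProbabilityTheory
open scoped NNReal ENNReal ComplexOrder

noncomputable section

/-- The single-qubit Pauli basis in the order `(I, Z, X, Y)`. -/
def pauli1 : Fin 4 → Matrix (Fin 2) (Fin 2) ℂ := ![1, PZ, PX, PY]

/-- The `N`-qubit Pauli basis: all `N`-fold Kronecker products of `{I, Z, X, Y}`. -/
def pauliN {N : ℕ} (s : Fin N → Fin 4) : Matrix (Fin N → Fin 2) (Fin N → Fin 2) ℂ :=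
  kron fun n => pauli1 (s n)

/-- The non-identity single-qubit Pauli basis, ordered `(Z, X, Y)`. -/
def pauliNI : Fin 3 → Matrix (Fin 2) (Fin 2) ℂ := ![PZ, PX, PY]

lemma integrable_cexp_mul_I {ν : Measure ℝ} [IsFiniteMeasure ν] :
    Integrable (fun x : ℝ => Complex.exp (x * Complex.I)) ν :=
  .of_bound (by fun_prop) 1 (.of_forall fun x => (Complex.norm_exp_ofReal_mul_I x).le)

lemma integral_cexp_mul_I_gaussianReal (m : ℝ) (v : ℝ≥0) :
    ∫ x : ℝ, Complex.exp (x * Complex.I) ∂gaussianReal m v =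
      (Real.exp (-(v : ℝ) / 2) : ℂ) * Complex.exp (m * Complex.I) := by
  have h := charFun_gaussianReal (μ := m) (v := v) 1
  rw [charFun_apply_real] at h
  simp only [Complex.ofReal_one, one_mul] at h
  rw [h, Complex.ofReal_exp, ← Complex.exp_add]
  congr 1
  push_cast
  ring

lemma integral_cos_gaussianReal (m : ℝ) (v : ℝ≥0) :
    ∫ x, Real.cos x ∂gaussianReal m v = Real.exp (-(v : ℝ) / 2) * Real.cos m := by
  have h := integral_re (integrable_cexp_mul_I (ν := gaussianReal m v))
  rw [integral_cexp_mul_I_gaussianReal] at h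
  simpa only [RCLike.re_to_complex, Complex.re_ofReal_mul, Complex.exp_ofReal_mul_I_re] using h

lemma integral_sin_gaussianReal (m : ℝ) (v : ℝ≥0) :
    ∫ x, Real.sin x ∂gaussianReal m v = Real.exp (-(v : ℝ) / 2) * Real.sin m := by
  have h := integral_im (integrable_cexp_mul_I (ν := gaussianReal m v))
  rw [integral_cexp_mul_I_gaussianReal] at h
  simpa only [RCLike.im_to_complex, Complex.im_ofReal_mul, Complex.exp_ofReal_mul_I_im] using h

lemma integrable_cos {ν : Measure ℝ} [IsFiniteMeasure ν] : Integrable Real.cos ν :=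
  .of_bound (by fun_prop) 1 (.of_forall Real.abs_cos_le_one)

lemma integrable_sin {ν : Measure ℝ} [IsFiniteMeasure ν] : Integrable Real.sin ν :=
  .of_bound (by fun_prop) 1 (.of_forall Real.abs_sin_le_one)

lemma integrable_mul_mul_pi {ν : Fin 3 → Measure ℝ} [∀ i, IsProbabilityMeasure (ν i)]
    {f g h : ℝ → ℝ} (hf : Integrable f (ν 0)) (hg : Integrable g (ν 1))
    (hh : Integrable h (ν 2)) :
    Integrable (fun x : Fin 3 → ℝ => f (x 0) * g (x 1) * h (x 2)) (Measure.pi ν) := by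
  have := Integrable.fintype_prod (μ := ν) (f := ![f, g, h]) (by
    intro i; fin_cases i <;> assumption)
  simpa [Fin.prod_univ_three] using this

lemma integral_mul_mul_pi {ν : Fin 3 → Measure ℝ} [∀ i, IsProbabilityMeasure (ν i)]
    (f g h : ℝ → ℝ) :
    ∫ x : Fin 3 → ℝ, f (x 0) * g (x 1) * h (x 2) ∂Measure.pi ν =
      (∫ x, f x ∂ν 0) * (∫ x, g x ∂ν 1) * ∫ x, h x ∂ν 2 := by
  have := integral_fintype_prod_eq_prod (μ := ν) (f := ![f, g, h])
  simpa [Fin.prod_univ_three] using this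

lemma ofReal_cos_eq_half (x : ℝ) :
    (Real.cos x : ℂ) = (Real.cos (x / 2) : ℂ) ^ 2 - (Real.sin (x / 2) : ℂ) ^ 2 := by
  norm_cast
  rw [← Real.cos_two_mul']
  congr 1
  ring

lemma ofReal_sin_eq_half (x : ℝ) :
    (Real.sin x : ℂ) = 2 * (Real.sin (x / 2) : ℂ) * (Real.cos (x / 2) : ℂ) := by
  norm_cast
  rw [← Real.sin_two_mul]
  congr 1
  ring

lemma ofReal_sin_sq_add_cos_sq (x : ℝ) :
    (Real.sin x : ℂ) ^ 2 + (Real.cos x : ℂ) ^ 2 = 1 :=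
  mod_cast Real.sin_sq_add_cos_sq x

lemma Rz_eq (x : ℝ) : Rz x =
    !![(Real.cos (x / 2) : ℂ) - Complex.I * Real.sin (x / 2), 0;
       0, (Real.cos (x / 2) : ℂ) + Complex.I * Real.sin (x / 2)] := by
  ext i j
  fin_cases i <;> fin_cases j <;> simp [Rz, rotG, PZ]

lemma Ry_eq_s9 (x : ℝ) : Ry x =
    !![(Real.cos (x / 2) : ℂ), -(Real.sin (x / 2) : ℂ);
       (Real.sin (x / 2) : ℂ), (Real.cos (x / 2) : ℂ)] := by
  ext i j
  fin_cases i <;> fin_cases j <;>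
    simp [Ry, rotG, PY, mul_right_comm Complex.I _ Complex.I]

lemma Rz_conj_one (x : ℝ) : Rz x * 1 * (Rz x)ᴴ = 1 := by
  have h := ofReal_sin_sq_add_cos_sq (x / 2)
  have hI := Complex.I_sq
  ext i j
  fin_cases i <;> fin_cases j <;>
    simp [Rz_eq, Matrix.mul_apply, Fin.sum_univ_two, -Complex.ofReal_cos, -Complex.ofReal_sin] <;>
    grind

lemma Rz_conj_PZ (x : ℝ) : Rz x * PZ * (Rz x)ᴴ = PZ := by
  have h := ofReal_sin_sq_add_cos_sq (x / 2)
  have hI := Complex.I_sq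
  ext i j
  fin_cases i <;> fin_cases j <;>
    simp [Rz_eq, PZ, Matrix.mul_apply, Fin.sum_univ_two, -Complex.ofReal_cos, -Complex.ofReal_sin] <;>
    grind

lemma Rz_conj_PX (x : ℝ) :
    Rz x * PX * (Rz x)ᴴ = (Real.cos x : ℂ) • PX + (Real.sin x : ℂ) • PY := by
  have h := ofReal_sin_sq_add_cos_sq (x / 2)
  have hI := Complex.I_sq
  ext i j
  fin_cases i <;> fin_cases j <;>
    simp [Rz_eq, PX, PY, Matrix.mul_apply, Fin.sum_univ_two,
      ofReal_cos_eq_half x, ofReal_sin_eq_half x, -Complex.ofReal_cos, -Complex.ofReal_sin] <;>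
    grind

lemma Rz_conj_PY (x : ℝ) :
    Rz x * PY * (Rz x)ᴴ = (Real.cos x : ℂ) • PY - (Real.sin x : ℂ) • PX := by
  have h := ofReal_sin_sq_add_cos_sq (x / 2)
  have hI := Complex.I_sq
  ext i j
  fin_cases i <;> fin_cases j <;>
    simp [Rz_eq, PX, PY, Matrix.mul_apply, Fin.sum_univ_two,
      ofReal_cos_eq_half x, ofReal_sin_eq_half x, -Complex.ofReal_cos, -Complex.ofReal_sin] <;>
    grind

lemma Ry_conj_one (x : ℝ) : Ry x * 1 * (Ry x)ᴴ = 1 := by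
  have h := ofReal_sin_sq_add_cos_sq (x / 2)
  have hI := Complex.I_sq
  ext i j
  fin_cases i <;> fin_cases j <;>
    simp [Ry_eq_s9, Matrix.mul_apply, Fin.sum_univ_two, -Complex.ofReal_cos, -Complex.ofReal_sin] <;>
    grind

lemma Ry_conj_PZ (x : ℝ) :
    Ry x * PZ * (Ry x)ᴴ = (Real.cos x : ℂ) • PZ + (Real.sin x : ℂ) • PX := by
  have h := ofReal_sin_sq_add_cos_sq (x / 2)
  have hI := Complex.I_sq
  ext i j
  fin_cases i <;> fin_cases j <;>
    simp [Ry_eq_s9, PX, PZ, Matrix.mul_apply, Fin.sum_univ_two,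
      ofReal_cos_eq_half x, ofReal_sin_eq_half x, -Complex.ofReal_cos, -Complex.ofReal_sin] <;>
    grind

lemma Ry_conj_PX (x : ℝ) :
    Ry x * PX * (Ry x)ᴴ = (Real.cos x : ℂ) • PX - (Real.sin x : ℂ) • PZ := by
  have h := ofReal_sin_sq_add_cos_sq (x / 2)
  have hI := Complex.I_sq
  ext i j
  fin_cases i <;> fin_cases j <;>
    simp [Ry_eq_s9, PX, PZ, Matrix.mul_apply, Fin.sum_univ_two,
      ofReal_cos_eq_half x, ofReal_sin_eq_half x, -Complex.ofReal_cos, -Complex.ofReal_sin] <;>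
    grind

lemma Ry_conj_PY (x : ℝ) : Ry x * PY * (Ry x)ᴴ = PY := by
  have h := ofReal_sin_sq_add_cos_sq (x / 2)
  have hI := Complex.I_sq
  ext i j
  fin_cases i <;> fin_cases j <;>
    simp [Ry_eq_s9, PY, Matrix.mul_apply, Fin.sum_univ_two, -Complex.ofReal_cos, -Complex.ofReal_sin] <;>
    grind

lemma encGate_conj (x : Fin 3 → ℝ) (P : Matrix (Fin 2) (Fin 2) ℂ) :
    encGate x * P * (encGate x)ᴴ =
      Rz (x 2) * (Ry (x 1) * (Rz (x 0) * P * (Rz (x 0))ᴴ) * (Ry (x 1))ᴴ) * (Rz (x 2))ᴴ := by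
  simp only [encGate, conjTranspose_mul, Matrix.mul_assoc]

lemma encGate_conj_one (x : Fin 3 → ℝ) : encGate x * 1 * (encGate x)ᴴ = 1 := by
  rw [encGate_conj, Rz_conj_one, Ry_conj_one, Rz_conj_one]

/-- The Bloch-sphere rotation matrix of `encGate x` in the ordered basis `(Z, X, Y)`. -/
def blochMatrix (x : Fin 3 → ℝ) : Matrix (Fin 3) (Fin 3) ℝ :=
  !![Real.cos (x 1), -(Real.cos (x 0) * Real.sin (x 1)), Real.sin (x 0) * Real.sin (x 1);
     Real.sin (x 1) * Real.cos (x 2),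
     Real.cos (x 0) * Real.cos (x 1) * Real.cos (x 2) - Real.sin (x 0) * Real.sin (x 2),
     -(Real.sin (x 0) * Real.cos (x 1) * Real.cos (x 2)) - Real.cos (x 0) * Real.sin (x 2);
     Real.sin (x 1) * Real.sin (x 2),
     Real.cos (x 0) * Real.cos (x 1) * Real.sin (x 2) + Real.sin (x 0) * Real.cos (x 2),
     -(Real.sin (x 0) * Real.cos (x 1) * Real.sin (x 2)) + Real.cos (x 0) * Real.cos (x 2)]

lemma encGate_conj_pauliNI (x : Fin 3 → ℝ) (a : Fin 3) :
    encGate x * pauliNI a * (encGate x)ᴴ =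
      ∑ b, (blochMatrix x b a : ℂ) • pauliNI b := by
  rw [encGate_conj]
  fin_cases a <;>
    simp [pauliNI, blochMatrix, Fin.sum_univ_three, Rz_conj_PZ, Rz_conj_PX, Rz_conj_PY,
      Ry_conj_PZ, Ry_conj_PX, Ry_conj_PY, Matrix.mul_add, Matrix.add_mul, Matrix.mul_sub,
      Matrix.sub_mul, -Complex.ofReal_cos, -Complex.ofReal_sin] <;>
    module

lemma trace_pauliNI (a : Fin 3) : (pauliNI a).trace = 0 := by
  fin_cases a <;> simp [pauliNI, PX, PY, PZ, trace_fin_two]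

lemma trace_pauliNI_mul_pauliNI (b a : Fin 3) :
    (pauliNI b * pauliNI a).trace = if b = a then 2 else 0 := by
  fin_cases b <;> fin_cases a <;>
    norm_num [pauliNI, PX, PY, PZ, trace_fin_two]

lemma trace_transfer_pauliNI (x : Fin 3 → ℝ) (b a : Fin 3) :
    (pauliNI b * encGate x * pauliNI a * (encGate x)ᴴ).trace = 2 * (blochMatrix x b a : ℂ) := by
  rw [Matrix.mul_assoc, Matrix.mul_assoc, ← Matrix.mul_assoc (encGate x), encGate_conj_pauliNI,
    Matrix.mul_sum, trace_sum]
  simp [trace_pauliNI_mul_pauliNI, mul_comm]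

lemma trace_transfer_one_right (x : Fin 3 → ℝ) (P : Matrix (Fin 2) (Fin 2) ℂ) :
    (P * encGate x * 1 * (encGate x)ᴴ).trace = P.trace := by
  rw [Matrix.mul_assoc, Matrix.mul_assoc, ← Matrix.mul_assoc (encGate x), encGate_conj_one,
    Matrix.mul_one]

lemma trace_transfer_one_left (x : Fin 3 → ℝ) (a : Fin 3) :
    (1 * encGate x * pauliNI a * (encGate x)ᴴ).trace = 0 := by
  rw [Matrix.one_mul, encGate_conj_pauliNI, trace_sum]
  simp [trace_pauliNI]

lemma pauli1_succ (a : Fin 3) : pauli1 a.succ = pauliNI a := rfl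

lemma integral_transfer_pauliNI (ν : Measure (Fin 3 → ℝ)) (b a : Fin 3) :
    (1 / 2 : ℂ) * ∫ x, (pauliNI b * encGate x * pauliNI a * (encGate x)ᴴ).trace ∂ν =
      ((∫ x, blochMatrix x b a ∂ν : ℝ) : ℂ) := by
  simp_rw [trace_transfer_pauliNI]
  rw [integral_const_mul, integral_complex_ofReal]
  ring

/-- The mean of the Bloch-sphere rotation under a product Gaussian measure, obtained by
replacing `cos (x i)` and `sin (x i)` by their expectations. -/
lemma integral_blochMatrix (μ : Fin 3 → ℝ) (v : Fin 3 → ℝ≥0)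
    (A : Fin 3 → ℝ) (hA : ∀ i, A i = Real.exp (-(v i : ℝ) / 2)) (b a : Fin 3) :
    ∫ x, blochMatrix x b a ∂(Measure.pi fun i => gaussianReal (μ i) (v i)) =
      (!![A 1 * Real.cos (μ 1), -(A 1 * Real.sin (μ 1) * (A 0 * Real.cos (μ 0))),
          A 1 * Real.sin (μ 1) * (A 0 * Real.sin (μ 0));
          A 1 * Real.sin (μ 1) * (A 2 * Real.cos (μ 2)),
          A 1 * Real.cos (μ 1) * (A 0 * Real.cos (μ 0)) * (A 2 * Real.cos (μ 2))
            - A 0 * Real.sin (μ 0) * (A 2 * Real.sin (μ 2)),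
          -(A 1 * Real.cos (μ 1) * (A 0 * Real.sin (μ 0)) * (A 2 * Real.cos (μ 2)))
            - A 0 * Real.cos (μ 0) * (A 2 * Real.sin (μ 2));
          A 1 * Real.sin (μ 1) * (A 2 * Real.sin (μ 2)),
          A 1 * Real.cos (μ 1) * (A 0 * Real.cos (μ 0)) * (A 2 * Real.sin (μ 2))
            + A 0 * Real.sin (μ 0) * (A 2 * Real.cos (μ 2)),
          -(A 1 * Real.cos (μ 1) * (A 0 * Real.sin (μ 0)) * (A 2 * Real.sin (μ 2)))
            + A 0 * Real.cos (μ 0) * (A 2 * Real.cos (μ 2))] :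
        Matrix (Fin 3) (Fin 3) ℝ) b a := by
  set ν : Fin 3 → Measure ℝ := fun i => gaussianReal (μ i) (v i)
  have hc (i) : ∫ x, Real.cos x ∂ν i = A i * Real.cos (μ i) := by
    rw [hA]; exact integral_cos_gaussianReal _ _
  have hs (i) : ∫ x, Real.sin x ∂ν i = A i * Real.sin (μ i) := by
    rw [hA]; exact integral_sin_gaussianReal _ _
  have h₁ (i) : ∫ _, (1 : ℝ) ∂ν i = 1 := by simp
  have i₁ (i) : Integrable (fun _ : ℝ => (1 : ℝ)) (ν i) := integrable_const 1
  have E (f g h : ℝ → ℝ) := integral_mul_mul_pi (ν := ν) f g h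
  have i011 {f h : ℝ → ℝ} (hf : Integrable f (ν 0)) (hh : Integrable h (ν 2)) :
      Integrable (fun x : Fin 3 → ℝ => f (x 0) * h (x 2)) (Measure.pi ν) := by
    simpa using integrable_mul_mul_pi hf (i₁ 1) hh
  match b, a with
  | 0, 0 =>
    have e := E (fun _ => 1) Real.cos (fun _ => 1)
    simp only [mul_one, one_mul, hc, h₁] at e
    exact e
  | 0, 1 =>
    have e := E Real.cos Real.sin (fun _ => 1)
    simp only [mul_one, hc, hs, h₁] at e
    refine (integral_neg _).trans ?_
    rw [e]
    simp only [Matrix.of_apply, Matrix.cons_val', Matrix.cons_val]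
    ring
  | 0, 2 =>
    have e := E Real.sin Real.sin (fun _ => 1)
    simp only [mul_one, hs, h₁] at e
    refine e.trans ?_
    simp only [Matrix.of_apply, Matrix.cons_val', Matrix.cons_val]
    ring
  | 1, 0 =>
    have e := E (fun _ => 1) Real.sin Real.cos
    simp only [one_mul, hc, hs, h₁] at e
    exact e
  | 1, 1 =>
    have e := E Real.cos Real.cos Real.cos
    have e' := E Real.sin (fun _ => 1) Real.sin
    simp only [mul_one, hc, hs, h₁] at e e'
    refine (integral_sub (integrable_mul_mul_pi integrable_cos integrable_cos integrable_cos)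
      (i011 integrable_sin integrable_sin)).trans ?_
    rw [e, e']
    simp only [Matrix.of_apply, Matrix.cons_val', Matrix.cons_val]
    ring
  | 1, 2 =>
    have e := E Real.sin Real.cos Real.cos
    have e' := E Real.cos (fun _ => 1) Real.sin
    simp only [mul_one, hc, hs, h₁] at e e'
    refine (integral_sub (integrable_mul_mul_pi integrable_sin integrable_cos integrable_cos).neg
      (i011 integrable_cos integrable_sin)).trans ?_
    simp only [Pi.neg_apply]
    rw [integral_neg, e, e']
    simp only [Matrix.of_apply, Matrix.cons_val', Matrix.cons_val]
    ring
  | 2, 0 =>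
    have e := E (fun _ => 1) Real.sin Real.sin
    simp only [one_mul, hs, h₁] at e
    exact e
  | 2, 1 =>
    have e := E Real.cos Real.cos Real.sin
    have e' := E Real.sin (fun _ => 1) Real.cos
    simp only [mul_one, hc, hs, h₁] at e e'
    refine (integral_add (integrable_mul_mul_pi integrable_cos integrable_cos integrable_sin)
      (i011 integrable_sin integrable_cos)).trans ?_
    rw [e, e']
    simp only [Matrix.of_apply, Matrix.cons_val', Matrix.cons_val]
    ring
  | 2, 2 =>
    have e := E Real.sin Real.cos Real.sin
    have e' := E Real.cos (fun _ => 1) Real.cos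
    simp only [mul_one, hc, hs, h₁] at e e'
    refine (integral_add (integrable_mul_mul_pi integrable_sin integrable_cos integrable_sin).neg
      (i011 integrable_cos integrable_cos)).trans ?_
    simp only [Pi.neg_apply]
    rw [integral_neg, e, e']
    simp only [Matrix.of_apply, Matrix.cons_val', Matrix.cons_val]
    ring

/-- For `x = (x₁,x₂,x₃)` with independent Gaussian entries
`xᵢ ~ N(μᵢ, σᵢ²)` and `Aᵢ = e^{−σᵢ²/2}`, the expected Pauli-basis transfer matrix of
the encoding gate `R(x) = R_z(x₃)R_y(x₂)R_z(x₁)`, whose `(b,a)` entry is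
`(1/2)·E[Tr[σ_b R(x) σ_a R(x)†]]` over the non-identity basis `(Z,X,Y)`, equals the
explicit `3×3` matrix of the paper, and the full `4×4` expected transfer matrix in the
ordered basis `(I,Z,X,Y)` equals `diag(1, 𝒯)`. -/
theorem statement9
    (μ : Fin 3 → ℝ) (v : Fin 3 → ℝ≥0)
    (A : Fin 3 → ℝ) (hA : ∀ i, A i = Real.exp (-(v i : ℝ) / 2))
    -- the product Gaussian measure on the data
    (μx : Measure (Fin 3 → ℝ))
    (hμx : μx = Measure.pi fun i => gaussianReal (μ i) (v i))
    -- the 3×3 block `𝒯` (rows/columns over the non-identity Pauli basis `(Z,X,Y)`)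
    (T : Matrix (Fin 3) (Fin 3) ℂ)
    (hT : ∀ b a, T b a =
      (1 / 2 : ℂ) * ∫ x, (pauliNI b * encGate x * pauliNI a * (encGate x)ᴴ).trace ∂μx)
    -- the full 4×4 expected transfer matrix (rows/columns over `(I,Z,X,Y)`)
    (Tfull : Matrix (Fin 4) (Fin 4) ℂ)
    (hTfull : ∀ b a, Tfull b a =
      (1 / 2 : ℂ) * ∫ x, (pauli1 b * encGate x * pauli1 a * (encGate x)ᴴ).trace ∂μx) :
    -- row Z
    T 0 0 = ((A 1 * Real.cos (μ 1) : ℝ) : ℂ) ∧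
    T 0 1 = ((-(A 1 * Real.sin (μ 1) * (A 0 * Real.cos (μ 0))) : ℝ) : ℂ) ∧
    T 0 2 = ((A 1 * Real.sin (μ 1) * (A 0 * Real.sin (μ 0)) : ℝ) : ℂ) ∧
    -- row X
    T 1 0 = ((A 1 * Real.sin (μ 1) * (A 2 * Real.cos (μ 2)) : ℝ) : ℂ) ∧
    T 1 1 = ((A 1 * Real.cos (μ 1) * (A 0 * Real.cos (μ 0)) * (A 2 * Real.cos (μ 2))
              - A 0 * Real.sin (μ 0) * (A 2 * Real.sin (μ 2)) : ℝ) : ℂ) ∧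
    T 1 2 = ((-(A 1 * Real.cos (μ 1) * (A 0 * Real.sin (μ 0)) * (A 2 * Real.cos (μ 2)))
              - A 0 * Real.cos (μ 0) * (A 2 * Real.sin (μ 2)) : ℝ) : ℂ) ∧
    -- row Y
    T 2 0 = ((A 1 * Real.sin (μ 1) * (A 2 * Real.sin (μ 2)) : ℝ) : ℂ) ∧
    T 2 1 = ((A 1 * Real.cos (μ 1) * (A 0 * Real.cos (μ 0)) * (A 2 * Real.sin (μ 2))
              + A 0 * Real.sin (μ 0) * (A 2 * Real.cos (μ 2)) : ℝ) : ℂ) ∧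
    T 2 2 = ((-(A 1 * Real.cos (μ 1) * (A 0 * Real.sin (μ 0)) * (A 2 * Real.sin (μ 2)))
              + A 0 * Real.cos (μ 0) * (A 2 * Real.cos (μ 2)) : ℝ) : ℂ) ∧
    -- `Tfull = diag(1, 𝒯)`
    Tfull 0 0 = 1 ∧
    (∀ j, j ≠ 0 → Tfull 0 j = 0 ∧ Tfull j 0 = 0) ∧
    (∀ b a : Fin 3, Tfull b.succ a.succ = T b a) := by
  subst hμx
  have hT' (b a) := (hT b a).trans ((integral_transfer_pauliNI _ b a).trans
    (congrArg _ (integral_blochMatrix μ v A hA b a)))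
  refine ⟨hT' 0 0, hT' 0 1, hT' 0 2, hT' 1 0, hT' 1 1, hT' 1 2, hT' 2 0, hT' 2 1, hT' 2 2,
    ?_, fun j hj => ?_, fun b a => ?_⟩
  · rw [hTfull, show pauli1 0 = 1 from rfl]
    simp_rw [trace_transfer_one_right]
    simp
  · obtain ⟨a, rfl⟩ := Fin.exists_succ_eq.mpr hj
    rw [hTfull, hTfull, show pauli1 0 = 1 from rfl, pauli1_succ]
    simp_rw [trace_transfer_one_right, trace_transfer_one_left, trace_pauliNI]
    simp
  · rw [hTfull, hT, pauli1_succ, pauli1_succ]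
end
end
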